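/- Let N, m be natural numbers with 1 ≤ m < N, and define g : ℝ → ℝ by g(P) = N · (P/m)^(m/N) · ((1−P)/(N−m))^((N−m)/N). Then g is antitone on the interval [m/N, 1]. -/

import Mathlib

open Real Set

/-- For positive weights `a + b = 1`, the function `x ↦ x ^ a * (1 - x) ^ b` is antitone to the
right of its maximum at `x = a`. -/
theorem antitoneOn_rpow_mul_one_sub_rpow {a b : ℝ} (ha : 0 < a) (hb : 0 ≤ b) (hab : a + b = 1) :
    AntitoneOn (fun x : ℝ => x ^ a * (1 - x) ^ b) (Set.Icc a 1) := by
  rintro x ⟨hax, hx1⟩ y ⟨-, hy1⟩ hxy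
  rcases hx1.eq_or_lt with rfl | hx1
  · rw [le_antisymm hy1 hxy]
  have hx : 0 < x := ha.trans_le hax
  have hy : 0 ≤ y := hx.le.trans hxy
  have hx' : 0 < 1 - x := sub_pos.2 hx1
  have hy' : 0 ≤ 1 - y := sub_nonneg.2 hy1
  have amgm := geom_mean_le_arith_mean2_weighted ha.le hb
    (div_nonneg hy hx.le) (div_nonneg hy' hx'.le) hab
  have mean_le_one : a * (y / x) + b * ((1 - y) / (1 - x)) ≤ 1 := by
    obtain rfl : b = 1 - a := by linarith
    have key : 1 - (a * (y / x) + (1 - a) * ((1 - y) / (1 - x))) =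
        (y - x) * (x - a) / (x * (1 - x)) := by
      field_simp
      ring
    have : 0 ≤ (y - x) * (x - a) / (x * (1 - x)) :=
      div_nonneg (mul_nonneg (sub_nonneg.2 hxy) (sub_nonneg.2 hax)) (mul_pos hx hx').le
    linarith
  have h := amgm.trans mean_le_one
  rw [div_rpow hy hx.le, div_rpow hy' hx'.le, div_mul_div_comm,
    div_le_one (mul_pos (rpow_pos_of_pos hx _) (rpow_pos_of_pos hx' _))] at h
  exact h

/-- the coherence N-concurrence of the Grover state, expressed
as a function of the success probability `P`,
`g(P) = N·(P/m)^(m/N)·((1−P)/(N−m))^((N−m)/N)`,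
is antitone on `[m/N, 1]`. -/
theorem grover_coherence_concurrence_of_prob_antitone
    (N m : ℕ) (hm : 1 ≤ m) (hmN : m < N) :
    AntitoneOn
      (fun P : ℝ => (N : ℝ) * (P / (m : ℝ)) ^ ((m : ℝ) / (N : ℝ)) *
        ((1 - P) / ((N : ℝ) - (m : ℝ))) ^ (((N : ℝ) - (m : ℝ)) / (N : ℝ)))
      (Set.Icc ((m : ℝ) / (N : ℝ)) 1) := by
  have hm0 : (0 : ℝ) < m := by exact_mod_cast hm
  have hd : (0 : ℝ) < (N : ℝ) - m := sub_pos.2 (by exact_mod_cast hmN)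
  have hN : (0 : ℝ) < N := by linarith
  have ha : (0 : ℝ) < m / N := div_pos hm0 hN
  have anti := antitoneOn_rpow_mul_one_sub_rpow ha (div_pos hd hN).le
    (by field_simp; ring : (m : ℝ) / N + ((N : ℝ) - m) / N = 1)
  have hc : (0 : ℝ) ≤ N / ((m : ℝ) ^ ((m : ℝ) / N) *
      ((N : ℝ) - m) ^ (((N : ℝ) - m) / N)) := by positivity
  refine AntitoneOn.congr (fun x hx y hy hxy => mul_le_mul_of_nonneg_left (anti hx hy hxy) hc) ?_
  rintro x ⟨hx, hx1⟩
  simp only [div_rpow (ha.le.trans hx) hm0.le, div_rpow (sub_nonneg.2 hx1) hd.le]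
  ring
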